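/- arXiv:1306.3674 — 2 statements merged into one kernel-verified Lean document; each statement's English description precedes it below -/
import Mathlib

section
/- There exist absolute constants 0 < c ≤ C < ∞ such that for every integer n≥1 and every real q with 1/2 ≤ q ≤ 1 − 4/n, if π is distributed according to the (n,q)-Mallows measure, then c·n·√(1−q) ≤ E(LIS(π)) ≤ C·n·√(1−q). -/
open Finset

/-- Number of inversions of a permutation of `Fin n`. -/
def mallowsInv {n : ℕ} (π : Equiv.Perm (Fin n)) : ℕ :=
  (Finset.univ.filter (fun p : Fin n × Fin n => p.1 < p.2 ∧ π p.2 < π p.1)).card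

/-- The `(n,q)`-Mallows probability mass function on `S_n`. -/
noncomputable def mallowsPMF (n : ℕ) (q : ℝ) (π : Equiv.Perm (Fin n)) : ℝ :=
  q ^ mallowsInv π / ∑ σ : Equiv.Perm (Fin n), q ^ mallowsInv σ

/-- Probability of an event under the `(n,q)`-Mallows measure. -/
noncomputable def mallowsProb (n : ℕ) (q : ℝ) (A : Set (Equiv.Perm (Fin n))) : ℝ :=
  ∑ π : Equiv.Perm (Fin n), A.indicator (mallowsPMF n q) π

/-- Expectation of a function under the `(n,q)`-Mallows measure. -/
noncomputable def mallowsExp (n : ℕ) (q : ℝ) (f : Equiv.Perm (Fin n) → ℝ) : ℝ :=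
  ∑ π : Equiv.Perm (Fin n), mallowsPMF n q π * f π

/-- Length of the longest increasing subsequence of a permutation of `Fin n`. -/
noncomputable def LIS {n : ℕ} (π : Equiv.Perm (Fin n)) : ℕ :=
  sSup {m | ∃ f : Fin m → Fin n, StrictMono f ∧ StrictMono (fun j => π (f j))}

/-- Length of the longest decreasing subsequence of a permutation of `Fin n`. -/
noncomputable def LDS {n : ℕ} (π : Equiv.Perm (Fin n)) : ℕ :=
  sSup {m | ∃ f : Fin m → Fin n, StrictMono f ∧ StrictAnti (fun j => π (f j))}


/-- `r` holds between the `π`-values of any two increasing positions in `I`. -/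
def RelOn {n : ℕ} (r : Fin n → Fin n → Prop) (π : Equiv.Perm (Fin n)) (I : Finset (Fin n)) : Prop :=
  ∀ i ∈ I, ∀ j ∈ I, i < j → r (π i) (π j)

open scoped Classical in
/-- The maximal size of a subset of `B` on which `π` satisfies `RelOn r`. -/
noncomputable def maxLen {n : ℕ} (r : Fin n → Fin n → Prop) (π : Equiv.Perm (Fin n))
    (B : Finset (Fin n)) : ℕ :=
  (B.powerset.filter (RelOn r π)).sup Finset.card

lemma RelOn.subset {n : ℕ} {r : Fin n → Fin n → Prop} {π : Equiv.Perm (Fin n)}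
    {I J : Finset (Fin n)} (h : RelOn r π J) (hIJ : I ⊆ J) : RelOn r π I :=
  fun i hi j hj hij => h i (hIJ hi) j (hIJ hj) hij

lemma card_le_maxLen {n : ℕ} {r : Fin n → Fin n → Prop} {π : Equiv.Perm (Fin n)}
    {I B : Finset (Fin n)} (hI : I ⊆ B) (h : RelOn r π I) : I.card ≤ maxLen r π B := by
  classical
  exact Finset.le_sup (f := Finset.card) (by simp [hI, h])

lemma exists_card_eq_maxLen {n : ℕ} (r : Fin n → Fin n → Prop) (π : Equiv.Perm (Fin n))
    (B : Finset (Fin n)) : ∃ I ⊆ B, RelOn r π I ∧ I.card = maxLen r π B := by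
  classical
  obtain ⟨I, hI, h⟩ := Finset.exists_mem_eq_sup (B.powerset.filter (RelOn r π))
    ⟨∅, by simp [RelOn]⟩ Finset.card
  simp only [Finset.mem_filter, Finset.mem_powerset] at hI
  exact ⟨I, hI.1, hI.2, h.symm⟩

lemma maxLen_mono {n : ℕ} (r : Fin n → Fin n → Prop) (π : Equiv.Perm (Fin n))
    {A B : Finset (Fin n)} (h : A ⊆ B) : maxLen r π A ≤ maxLen r π B := by
  obtain ⟨I, hI, hr, hc⟩ := exists_card_eq_maxLen r π A
  exact hc ▸ card_le_maxLen (hI.trans h) hr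

lemma mallowsInv_mul_le {n : ℕ} {blk : Fin n → ℕ} (hblk : Monotone blk) {m k : ℕ}
    (hm : (Finset.univ.filter (fun i => blk i = k)).card ≤ m) {I : Finset (Fin n)}
    (hI : ∀ i ∈ I, blk i = k) (π σ : Equiv.Perm (Fin n)) (hσ : ∀ i, i ∉ I → σ i = i) :
    mallowsInv (π * σ) ≤ mallowsInv π + 2 * m * I.card := by
  classical
  set B := Finset.univ.filter (fun i => blk i = k) with hB
  have hmem : ∀ i, σ i ∉ I → σ i = i := fun i h => σ.injective (hσ _ h)
  have hb : ∀ i, blk (σ i) = blk i := by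
    intro i
    by_cases h : σ i ∈ I
    · by_cases h' : i ∈ I
      · rw [hI _ h, hI _ h']
      · rw [hσ _ h']
    · rw [hmem _ h]
  have hcard : mallowsInv (π * σ) ≤
      ((Finset.univ.filter (fun p : Fin n × Fin n => p.1 < p.2 ∧ π p.2 < π p.1)) ∪
        (I ×ˢ B ∪ B ×ˢ I)).card := by
    unfold mallowsInv
    refine Finset.card_le_card_of_injOn (fun p => (σ p.1, σ p.2)) ?_ ?_
    · rintro ⟨i, j⟩ hij
      obtain ⟨hlt, hinv⟩ := (Finset.mem_filter.1 (Finset.mem_coe.1 hij)).2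
      simp only [Equiv.Perm.mul_apply] at hlt hinv
      simp only [Finset.coe_union, Set.mem_union, Finset.mem_coe, Finset.mem_filter,
        Finset.mem_univ, true_and, Finset.mem_product, hB, hb]
      by_cases hi : σ i ∈ I
      · have hik := hI _ hi
        rw [hb] at hik
        rcases (hblk hlt.le).eq_or_lt with h | h
        · right; left; exact ⟨hi, by omega⟩
        · left
          refine ⟨?_, hinv⟩
          by_contra hc
          have := hblk (not_lt.1 hc)
          rw [hb, hb] at this
          omega
      · by_cases hj : σ j ∈ I
        · have hik := hI _ hj
          rw [hb] at hik
          rcases (hblk hlt.le).eq_or_lt with h | h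
          · right; right; exact ⟨by omega, hj⟩
          · left
            refine ⟨?_, hinv⟩
            by_contra hc
            have := hblk (not_lt.1 hc)
            rw [hb, hb] at this
            omega
        · left
          refine ⟨?_, hinv⟩
          rw [hmem _ hi, hmem _ hj]; exact hlt
    · rintro ⟨i, j⟩ _ ⟨i', j'⟩ _ h
      simpa using h
  refine hcard.trans ((Finset.card_union_le _ _).trans ?_)
  refine Nat.add_le_add_left ((Finset.card_union_le _ _).trans ?_) _
  rw [Finset.card_product, Finset.card_product]
  nlinarith [Nat.mul_le_mul_left I.card hm]

lemma eq_one_of_relOn {n : ℕ} {r : Fin n → Fin n → Prop} (hr : ∀ a b, r a b → ¬ r b a)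
    {I : Finset (Fin n)} {π : Equiv.Perm (Fin n)} (τ : Equiv.Perm {i // i ∈ I})
    (h1 : RelOn r π I) (h2 : RelOn r (π * Equiv.Perm.ofSubtype τ) I) : τ = 1 := by
  have hmono : StrictMono τ := by
    intro a b hab
    by_contra hc
    have hne : τ b ≠ τ a := fun h => hab.ne' (τ.injective h)
    have hlt : τ b < τ a := lt_of_le_of_ne (not_lt.1 hc) hne
    have e1 := h1 _ (τ b).2 _ (τ a).2 hlt
    have e2 := h2 _ a.2 _ b.2 hab
    simp only [Equiv.Perm.mul_apply, Equiv.Perm.ofSubtype_apply_coe] at e2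
    exact hr _ _ e1 e2
  have := (StrictMono.range_inj hmono strictMono_id).1 (by simp)
  ext x
  simp [this]

lemma sum_relOn_le {n : ℕ} {q : ℝ} (hq0 : 0 < q) (hq1 : q ≤ 1) {blk : Fin n → ℕ}
    (hblk : Monotone blk) {m k : ℕ}
    (hm : (Finset.univ.filter (fun i => blk i = k)).card ≤ m) {I : Finset (Fin n)}
    (hI : ∀ i ∈ I, blk i = k) {r : Fin n → Fin n → Prop} (hr : ∀ a b, r a b → ¬ r b a)
    [DecidablePred fun π : Equiv.Perm (Fin n) => RelOn r π I] :
    (I.card.factorial : ℝ) * q ^ (2 * m * I.card) *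
      ∑ π : Equiv.Perm (Fin n) with RelOn r π I, q ^ mallowsInv π ≤
      ∑ π : Equiv.Perm (Fin n), q ^ mallowsInv π := by
  classical
  set F := Finset.univ.filter (fun π : Equiv.Perm (Fin n) => RelOn r π I) with hF
  let g : Equiv.Perm {i // i ∈ I} × Equiv.Perm (Fin n) → Equiv.Perm (Fin n) :=
    fun p => p.2 * Equiv.Perm.ofSubtype p.1
  have hinj : Set.InjOn g ((Finset.univ : Finset (Equiv.Perm {i // i ∈ I})) ×ˢ F : Finset _) := by
    rintro ⟨σ, π⟩ h ⟨σ', π'⟩ h' heq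
    simp only [Finset.coe_product, Set.mem_prod, Finset.mem_coe, hF, Finset.mem_filter,
      Finset.mem_univ, true_and] at h h'
    simp only [g] at heq
    have e : π' = π * Equiv.Perm.ofSubtype (σ * σ'⁻¹) := by
      rw [map_mul, ← mul_assoc, heq, map_inv, mul_assoc, mul_inv_cancel, mul_one]
    have h3 := eq_one_of_relOn hr (σ * σ'⁻¹) h (e ▸ h')
    rw [h3] at e
    have h4 : σ = σ' := by simpa [mul_inv_eq_one] using h3
    simp [h4, e]
  calc (I.card.factorial : ℝ) * q ^ (2 * m * I.card) * ∑ π ∈ F, q ^ mallowsInv π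
      = ∑ _σ : Equiv.Perm {i // i ∈ I}, ∑ π ∈ F, q ^ (2 * m * I.card) * q ^ mallowsInv π := by
        rw [Finset.sum_const, Finset.card_univ, Fintype.card_perm, Fintype.card_coe,
          ← Finset.mul_sum, nsmul_eq_mul, mul_assoc]
    _ ≤ ∑ σ : Equiv.Perm {i // i ∈ I}, ∑ π ∈ F, q ^ mallowsInv (g (σ, π)) := by
        refine Finset.sum_le_sum fun σ _ => Finset.sum_le_sum fun π _ => ?_
        rw [← pow_add, add_comm]
        refine pow_le_pow_of_le_one hq0.le hq1 (mallowsInv_mul_le hblk hm hI π _ ?_)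
        intro i hi
        exact Equiv.Perm.ofSubtype_apply_of_not_mem _ hi
    _ = ∑ π ∈ (Finset.univ ×ˢ F).image g, q ^ mallowsInv π := by
        rw [Finset.sum_image hinj, Finset.sum_product]
    _ ≤ _ := Finset.sum_le_sum_of_subset_of_nonneg (Finset.subset_univ _)
        (fun _ _ _ => by positivity)

lemma two_pow_maxLen_le {n : ℕ} (r : Fin n → Fin n → Prop) (π : Equiv.Perm (Fin n))
    (B : Finset (Fin n)) [DecidablePred (RelOn r π)] :
    2 ^ maxLen r π B ≤ (B.powerset.filter (RelOn r π)).card := by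
  obtain ⟨I, hI, hr, hc⟩ := exists_card_eq_maxLen r π B
  rw [← hc, ← Finset.card_powerset]
  refine Finset.card_le_card fun J hJ => ?_
  rw [Finset.mem_powerset] at hJ
  simp only [Finset.mem_filter, Finset.mem_powerset]
  exact ⟨hJ.trans hI, hr.subset hJ⟩

lemma sum_choose_div_factorial_le {b m : ℕ} (hb : b ≤ m) {K : ℝ} (hK : 0 ≤ K) :
    ∑ k ∈ Finset.range (b + 1), (b.choose k : ℝ) * (K ^ k / k.factorial) ≤
      Real.exp (2 * √(m * K)) := by
  have hmK : 0 ≤ (m : ℝ) * K := by positivity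
  calc ∑ k ∈ Finset.range (b + 1), (b.choose k : ℝ) * (K ^ k / k.factorial)
      ≤ ∑ k ∈ Finset.range (b + 1), (√(m * K) ^ k / k.factorial) ^ 2 := by
        refine Finset.sum_le_sum fun k _ => ?_
        have h1 : (b.choose k : ℝ) ≤ (m : ℝ) ^ k / k.factorial :=
          (Nat.choose_le_pow_div k b).trans (by gcongr)
        calc (b.choose k : ℝ) * (K ^ k / k.factorial)
            ≤ (m : ℝ) ^ k / k.factorial * (K ^ k / k.factorial) := by gcongr
          _ = ((m * K) ^ k) / k.factorial ^ 2 := by rw [mul_pow]; field_simp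
          _ = _ := by
            rw [div_pow, ← pow_mul, mul_comm k 2, pow_mul, Real.sq_sqrt hmK]
    _ ≤ (∑ k ∈ Finset.range (b + 1), √(m * K) ^ k / k.factorial) ^ 2 :=
        Finset.sum_sq_le_sq_sum_of_nonneg (fun k _ => by positivity)
    _ ≤ (Real.exp √(m * K)) ^ 2 := by
        gcongr
        exact Real.sum_le_exp_of_nonneg (Real.sqrt_nonneg _) _
    _ = _ := by rw [← Real.exp_nat_mul]; norm_num

lemma sum_two_pow_maxLen_le {n : ℕ} {q : ℝ} (hq0 : 0 < q) (hq1 : q ≤ 1) {blk : Fin n → ℕ}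
    (hblk : Monotone blk) {m k : ℕ}
    (hm : (Finset.univ.filter (fun i => blk i = k)).card ≤ m)
    {r : Fin n → Fin n → Prop} (hr : ∀ a b, r a b → ¬ r b a) :
    ∑ π : Equiv.Perm (Fin n),
      q ^ mallowsInv π * 2 ^ maxLen r π (Finset.univ.filter (fun i => blk i = k)) ≤
      Real.exp (2 * √(m * (q ^ (2 * m))⁻¹)) * ∑ π : Equiv.Perm (Fin n), q ^ mallowsInv π := by
  classical
  set B := Finset.univ.filter (fun i => blk i = k) with hB
  set Z := ∑ π : Equiv.Perm (Fin n), q ^ mallowsInv π with hZ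
  have hZ0 : 0 ≤ Z := Finset.sum_nonneg fun _ _ => by positivity
  set K := (q ^ (2 * m))⁻¹ with hK
  have hK0 : 0 ≤ K := by positivity
  calc ∑ π : Equiv.Perm (Fin n), q ^ mallowsInv π * 2 ^ maxLen r π B
      ≤ ∑ π : Equiv.Perm (Fin n), ∑ I ∈ B.powerset,
          if RelOn r π I then q ^ mallowsInv π else 0 := by
        refine Finset.sum_le_sum fun π _ => ?_
        rw [← Finset.sum_filter, Finset.sum_const, nsmul_eq_mul, mul_comm]
        gcongr
        exact_mod_cast two_pow_maxLen_le r π B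
    _ = ∑ I ∈ B.powerset, ∑ π : Equiv.Perm (Fin n) with RelOn r π I, q ^ mallowsInv π := by
        rw [Finset.sum_comm]
        simp only [Finset.sum_filter]
    _ ≤ ∑ I ∈ B.powerset, K ^ I.card / I.card.factorial * Z := by
        refine Finset.sum_le_sum fun I hI => ?_
        have hI' : ∀ i ∈ I, blk i = k := fun i hi =>
          (Finset.mem_filter.1 (Finset.mem_powerset.1 hI hi)).2
        have h := sum_relOn_le hq0 hq1 hblk hm hI' hr
        rw [← hZ] at h
        rw [hK, inv_pow, ← pow_mul, div_mul_eq_mul_div, le_div_iff₀ (by positivity),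
          inv_mul_eq_div, le_div_iff₀ (by positivity)]
        linarith
    _ = (∑ j ∈ Finset.range (B.card + 1), (B.card.choose j : ℝ) * (K ^ j / j.factorial)) * Z := by
        rw [← Finset.sum_mul, Finset.sum_powerset_apply_card
          (f := fun j => K ^ j / (j.factorial : ℝ))]
        simp [nsmul_eq_mul]
    _ ≤ _ := by
        gcongr
        exact sum_choose_div_factorial_le hm hK0

lemma sum_maxLen_le {n : ℕ} {q : ℝ} (hq0 : 0 < q) (hq1 : q ≤ 1) {blk : Fin n → ℕ}
    (hblk : Monotone blk) {m k : ℕ}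
    (hm : (Finset.univ.filter (fun i => blk i = k)).card ≤ m)
    {r : Fin n → Fin n → Prop} (hr : ∀ a b, r a b → ¬ r b a) :
    ∑ π : Equiv.Perm (Fin n),
      q ^ mallowsInv π * (maxLen r π (Finset.univ.filter (fun i => blk i = k)) : ℝ) ≤
      4 * √(m * (q ^ (2 * m))⁻¹) * ∑ π : Equiv.Perm (Fin n), q ^ mallowsInv π := by
  set B := Finset.univ.filter (fun i => blk i = k) with hB
  set a := 2 * √(m * (q ^ (2 * m))⁻¹) with ha
  have ha0 : 0 ≤ a := by positivity
  have h := sum_two_pow_maxLen_le hq0 hq1 hblk hm hr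
  rw [← ha, ← hB] at h
  have key : ∀ L : ℕ, Real.exp a * (1 + L / 2 - a) ≤ 2 ^ L := by
    intro L
    have h1 : (2 : ℝ) ^ L = Real.exp a * Real.exp (L * Real.log 2 - a) := by
      rw [← Real.exp_add, add_sub_cancel, Real.exp_nat_mul, Real.exp_log (by norm_num)]
    rw [h1]
    gcongr
    have h2 := Real.add_one_le_exp (L * Real.log 2 - a)
    have h3 := Real.log_two_gt_d9
    have : (L : ℝ) * (1 / 2) ≤ L * Real.log 2 := by gcongr; linarith
    linarith
  have h4 : ∑ π : Equiv.Perm (Fin n), q ^ mallowsInv π *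
      (Real.exp a * (1 + (maxLen r π B : ℝ) / 2 - a)) ≤
      Real.exp a * ∑ π : Equiv.Perm (Fin n), q ^ mallowsInv π :=
    (Finset.sum_le_sum fun π _ => by gcongr; exact key _).trans h
  have h5 : ∑ π : Equiv.Perm (Fin n), q ^ mallowsInv π *
      (Real.exp a * (1 + (maxLen r π B : ℝ) / 2 - a)) =
      Real.exp a * ((1 - a) * ∑ π : Equiv.Perm (Fin n), q ^ mallowsInv π +
        (∑ π : Equiv.Perm (Fin n), q ^ mallowsInv π * (maxLen r π B : ℝ)) / 2) := by
    rw [Finset.mul_sum, Finset.sum_div, ← Finset.sum_add_distrib, Finset.mul_sum]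
    refine Finset.sum_congr rfl fun π _ => ?_
    ring
  rw [h5, mul_le_mul_iff_right₀ (Real.exp_pos a)] at h4
  linarith

/-! ### Longest monotone subsequences and blocks -/

lemma LIS_eq_maxLen {n : ℕ} (π : Equiv.Perm (Fin n)) : LIS π = maxLen (· < ·) π Finset.univ := by
  classical
  have hub : ∀ m ∈ {m | ∃ f : Fin m → Fin n, StrictMono f ∧ StrictMono (fun j => π (f j))},
      m ≤ maxLen (· < ·) π Finset.univ := by
    rintro m ⟨f, hf, hπ⟩
    have := card_le_maxLen (π := π) (r := (· < ·)) (Finset.subset_univ (Finset.univ.image f)) (by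
      intro i hi j hj hij
      obtain ⟨a, -, rfl⟩ := Finset.mem_image.1 hi
      obtain ⟨b, -, rfl⟩ := Finset.mem_image.1 hj
      exact hπ (hf.lt_iff_lt.1 hij))
    rwa [Finset.card_image_of_injective _ hf.injective, Finset.card_univ, Fintype.card_fin] at this
  refine le_antisymm (csSup_le' hub) ?_
  obtain ⟨I, -, hr, hc⟩ := exists_card_eq_maxLen (· < ·) π Finset.univ
  rw [← hc]
  refine le_csSup ⟨_, hub⟩ ⟨I.orderEmbOfFin rfl, (I.orderEmbOfFin rfl).strictMono, ?_⟩
  intro a b hab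
  exact hr _ (I.orderEmbOfFin_mem rfl a) _ (I.orderEmbOfFin_mem rfl b)
    ((I.orderEmbOfFin rfl).strictMono hab)

lemma maxLen_univ_le_sum {n : ℕ} (r : Fin n → Fin n → Prop) (π : Equiv.Perm (Fin n))
    {blk : Fin n → ℕ} {N : ℕ} (hN : ∀ i, blk i < N) :
    maxLen r π Finset.univ ≤
      ∑ k ∈ Finset.range N, maxLen r π (Finset.univ.filter (fun i => blk i = k)) := by
  classical
  obtain ⟨I, -, hr, hc⟩ := exists_card_eq_maxLen r π Finset.univ
  rw [← hc, Finset.card_eq_sum_card_fiberwise (f := blk) (t := Finset.range N)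
    (fun i _ => by simpa using hN i)]
  refine Finset.sum_le_sum fun k _ => card_le_maxLen ?_ (hr.subset (Finset.filter_subset _ _))
  exact Finset.filter_subset_filter _ (Finset.subset_univ _)

lemma sum_maxLen_le_LIS {n : ℕ} (π : Equiv.Perm (Fin n)) {blk : Fin n → ℕ}
    (hblk : Monotone blk) (N : ℕ) :
    ∑ k ∈ Finset.range N,
      maxLen (· < ·) π (Finset.univ.filter (fun i => blk i = k ∧ blk (π i) = k)) ≤ LIS π := by
  classical
  rw [LIS_eq_maxLen]
  choose I hI hr hc using fun k : ℕ => exists_card_eq_maxLen (· < ·) π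
    (Finset.univ.filter (fun i => blk i = k ∧ blk (π i) = k))
  have hb : ∀ k, ∀ i ∈ I k, blk i = k ∧ blk (π i) = k := fun k i hi =>
    (Finset.mem_filter.1 (hI k hi)).2
  have hcard : ((Finset.range N).biUnion I).card = ∑ k ∈ Finset.range N, (I k).card := by
    refine Finset.card_biUnion fun k _ l _ hkl => ?_
    rw [Function.onFun, Finset.disjoint_left]
    intro i hi hj
    exact hkl ((hb k i hi).1.symm.trans (hb l i hj).1)
  simp only [← hc]
  rw [← hcard]
  refine card_le_maxLen (Finset.subset_univ _) ?_
  intro i hi j hj hij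
  obtain ⟨k, -, hk⟩ := Finset.mem_biUnion.1 hi
  obtain ⟨l, -, hl⟩ := Finset.mem_biUnion.1 hj
  have h1 := hb k i hk
  have h2 := hb l j hl
  rcases (hblk hij.le).eq_or_lt with h | h
  · have hkl : k = l := by omega
    subst hkl
    exact hr k i hk j hl hij
  · by_contra hc'
    have := hblk (not_lt.1 hc')
    omega

lemma card_le_maxLen_mul_maxLen {n : ℕ} (π : Equiv.Perm (Fin n)) (X : Finset (Fin n)) :
    X.card ≤ maxLen (· < ·) π X * maxLen (· > ·) π X := by
  classical
  let X' : Fin n → Finset (Fin n) := fun i => X.filter (· ≤ i)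
  let ℓ : (Fin n → Fin n → Prop) → Fin n → ℕ := fun r i =>
    ((X' i).powerset.filter (fun I => RelOn r π I ∧ i ∈ I)).sup Finset.card
  have hle : ∀ (r) (i), i ∈ X → 1 ≤ ℓ r i ∧ ℓ r i ≤ maxLen r π X := by
    intro r i hi
    constructor
    · refine Finset.le_sup (f := Finset.card)
        (s := (X' i).powerset.filter (fun I => RelOn r π I ∧ i ∈ I)) (b := {i}) ?_
      simp only [X', Finset.mem_filter, Finset.mem_powerset, Finset.mem_singleton, and_true,
        Finset.singleton_subset_iff, le_refl, hi, true_and]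
      intro a ha b hb hab
      rw [Finset.mem_singleton] at ha hb
      exact absurd hab (by simp [ha, hb])
    · refine Finset.sup_le fun I hI => ?_
      simp only [Finset.mem_filter, Finset.mem_powerset] at hI
      exact card_le_maxLen (hI.1.trans (Finset.filter_subset _ _)) hI.2.1
  have hlt : ∀ (r : Fin n → Fin n → Prop) (i j), (∀ a b c, r a b → r b c → r a c) →
      i ∈ X → j ∈ X → i < j → r (π i) (π j) → ℓ r i < ℓ r j := by
    intro r i j htr hi hj hij hr
    have hne : ((X' i).powerset.filter (fun I => RelOn r π I ∧ i ∈ I)).Nonempty := by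
      by_contra hc
      have := (hle r i hi).1
      simp only [Finset.not_nonempty_iff_eq_empty] at hc
      simp only [ℓ, hc] at this
      simp at this
    obtain ⟨I, hI, hcard⟩ := Finset.exists_mem_eq_sup _ hne Finset.card
    have hcard' : ℓ r i = I.card := hcard
    simp only [Finset.mem_filter, Finset.mem_powerset] at hI
    have hIi : ∀ a ∈ I, a ∈ X ∧ a ≤ i := fun a ha => Finset.mem_filter.1 (hI.1 ha)
    have hjI : j ∉ I := fun h => absurd (hIi j h).2 (not_le.2 hij)
    rw [hcard', ← Nat.succ_le_iff, Nat.succ_eq_add_one, ← Finset.card_insert_of_notMem hjI]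
    refine Finset.le_sup (f := Finset.card)
      (s := (X' j).powerset.filter (fun I => RelOn r π I ∧ j ∈ I)) (b := insert j I) ?_
    simp only [X', Finset.mem_filter, Finset.mem_powerset, Finset.mem_insert_self, and_true]
    have hrel : ∀ a ∈ I, r (π a) (π j) := by
      intro a ha
      rcases (hIi a ha).2.eq_or_lt with h | h
      · rwa [h]
      · exact htr _ _ _ (hI.2.1 a ha i hI.2.2 h) hr
    refine ⟨fun a ha => ?_, fun a ha b hb hab => ?_⟩
    · rcases Finset.mem_insert.1 ha with rfl | ha
      · simp [hj]
      · simp only [Finset.mem_filter]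
        exact ⟨(hIi a ha).1, (hIi a ha).2.trans hij.le⟩
    · rcases Finset.mem_insert.1 ha with ha1 | ha1 <;>
        rcases Finset.mem_insert.1 hb with hb1 | hb1
      · exact absurd hab (by simp [ha1, hb1])
      · exact absurd ((hIi b hb1).2.trans_lt hij) (not_lt.2 (ha1 ▸ hab.le))
      · exact hb1 ▸ hrel a ha1
      · exact hI.2.1 a ha1 b hb1 hab
  have hsep : ∀ i ∈ X, ∀ j ∈ X, i < j →
      (ℓ (· < ·) i, ℓ (· > ·) i) ≠ (ℓ (· < ·) j, ℓ (· > ·) j) := by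
    intro i hi j hj hij h
    rw [Prod.mk.injEq] at h
    rcases lt_or_gt_of_ne (fun e => hij.ne (π.injective e) : π i ≠ π j) with h' | h'
    · exact (hlt (· < ·) i j (fun _ _ _ => lt_trans) hi hj hij h').ne h.1
    · exact (hlt (· > ·) i j (fun _ _ _ h1 h2 => gt_trans h1 h2) hi hj hij h').ne h.2
  have := Finset.card_le_card_of_injOn (s := X)
    (t := Finset.Icc 1 (maxLen (· < ·) π X) ×ˢ Finset.Icc 1 (maxLen (· > ·) π X))
    (fun i => (ℓ (· < ·) i, ℓ (· > ·) i))
    (fun i hi => by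
      simp only [Finset.coe_product, Set.mem_prod, Finset.mem_coe, Finset.mem_Icc]
      exact ⟨hle _ i hi, hle _ i hi⟩)
    (fun i hi j hj h => by
      by_contra hne
      rcases lt_or_gt_of_ne hne with h' | h'
      · exact hsep i hi j hj h' h
      · exact hsep j hj i hi h' h.symm)
  simpa using this

/-! ### Expected number of inversions -/

lemma mallowsInv_eq_sum {n : ℕ} (π : Equiv.Perm (Fin n)) :
    mallowsInv π = ∑ i, ∑ j, if i < j ∧ π j < π i then 1 else 0 := by
  unfold mallowsInv
  rw [Finset.card_filter, Fintype.sum_prod_type]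

/-- The permutation sending `0` to `p` whose remaining values are ordered as those of `e`. -/
def consPerm {n : ℕ} (p : Fin (n + 1)) (e : Equiv.Perm (Fin n)) : Equiv.Perm (Fin (n + 1)) :=
  (Equiv.Perm.decomposeFin.symm (0, e)).trans p.cycleRange.symm

lemma consPerm_zero {n : ℕ} (p : Fin (n + 1)) (e : Equiv.Perm (Fin n)) : consPerm p e 0 = p := by
  simp [consPerm]

lemma consPerm_succ {n : ℕ} (p : Fin (n + 1)) (e : Equiv.Perm (Fin n)) (j : Fin n) :
    consPerm p e j.succ = p.succAbove (e j) := by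
  simp [consPerm]

lemma consPerm_bijective (n : ℕ) :
    Function.Bijective (fun x : Fin (n + 1) × Equiv.Perm (Fin n) => consPerm x.1 x.2) := by
  rw [Fintype.bijective_iff_injective_and_card]
  constructor
  · rintro ⟨p, e⟩ ⟨p', e'⟩ h
    have h : consPerm p e = consPerm p' e' := h
    have hp : p = p' := by rw [← consPerm_zero p e, h, consPerm_zero]
    subst hp
    have he : e = e' := by
      ext j
      have := congrArg (fun f => f j.succ) h
      simp only [consPerm_succ] at this
      rw [Fin.succAbove_right_injective this]
    rw [he]
  · simp [Fintype.card_perm, Nat.factorial_succ]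

lemma mallowsInv_consPerm {n : ℕ} (p : Fin (n + 1)) (e : Equiv.Perm (Fin n)) :
    mallowsInv (consPerm p e) = p + mallowsInv e := by
  rw [mallowsInv_eq_sum, mallowsInv_eq_sum, Fin.sum_univ_succ]
  congr 1
  · rw [Fin.sum_univ_succ]
    simp only [consPerm_zero, consPerm_succ, lt_irrefl, false_and, if_false, zero_add,
      Fin.succ_pos, true_and]
    rw [Equiv.sum_comp e (fun k => if p.succAbove k < p then 1 else 0)]
    rw [← Finset.card_filter]
    simp only [Fin.succAbove_lt_iff_castSucc_lt]
    have : (Finset.univ.filter (fun k : Fin n => k.castSucc < p)).map Fin.valEmbedding =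
        Finset.range p := by
      ext a
      simp only [Finset.mem_map, Finset.mem_filter, Finset.mem_univ, true_and,
        Fin.valEmbedding_apply, Finset.mem_range]
      constructor
      · rintro ⟨k, hk, rfl⟩
        exact hk
      · intro ha
        exact ⟨⟨a, by omega⟩, by simpa [Fin.lt_def] using ha, rfl⟩
    rw [← Finset.card_map Fin.valEmbedding, this, Finset.card_range]
  · refine Finset.sum_congr rfl fun i _ => ?_
    rw [Fin.sum_univ_succ]
    simp [consPerm_succ, Fin.succAbove_lt_succAbove_iff]

lemma sum_perm_succ {n : ℕ} (f : Equiv.Perm (Fin (n + 1)) → ℝ) :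
    ∑ π, f π = ∑ p : Fin (n + 1), ∑ e : Equiv.Perm (Fin n), f (consPerm p e) := by
  rw [← Fintype.sum_prod_type' (f := fun p e => f (consPerm p e))]
  exact (Function.Bijective.sum_comp (consPerm_bijective n) f).symm

lemma one_sub_mul_sum_mul_pow_le {q : ℝ} (hq0 : 0 < q) (hq1 : q ≤ 1) (N : ℕ) :
    (1 - q) * ∑ p ∈ Finset.range N, (p : ℝ) * q ^ p ≤ ∑ p ∈ Finset.range N, q ^ p := by
  have h : (1 - q) * ∑ p ∈ Finset.range N, (p : ℝ) * q ^ p + N * q ^ N ≤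
      ∑ p ∈ Finset.range N, q ^ p := by
    induction N with
    | zero => simp
    | succ N ih =>
      rw [Finset.sum_range_succ, Finset.sum_range_succ, pow_succ]
      push_cast
      nlinarith [pow_pos hq0 N]
  have : 0 ≤ (N : ℝ) * q ^ N := by positivity
  linarith

lemma sum_mallowsInv_le {q : ℝ} (hq0 : 0 < q) (hq1 : q ≤ 1) (n : ℕ) :
    (1 - q) * ∑ π : Equiv.Perm (Fin n), q ^ mallowsInv π * (mallowsInv π : ℝ) ≤
      n * ∑ π : Equiv.Perm (Fin n), q ^ mallowsInv π := by
  induction n with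
  | zero => simp [mallowsInv]
  | succ n ih =>
    rw [sum_perm_succ, sum_perm_succ]
    simp only [mallowsInv_consPerm, pow_add]
    set Z := ∑ π : Equiv.Perm (Fin n), q ^ mallowsInv π with hZ
    set D := ∑ π : Equiv.Perm (Fin n), q ^ mallowsInv π * (mallowsInv π : ℝ) with hD
    have hZ0 : 0 ≤ Z := Finset.sum_nonneg fun _ _ => by positivity
    have e1 : ∑ p : Fin (n + 1), ∑ e : Equiv.Perm (Fin n),
        q ^ (p : ℕ) * q ^ mallowsInv e * (((p : ℕ) + mallowsInv e : ℕ) : ℝ) =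
        (∑ p ∈ Finset.range (n + 1), (p : ℝ) * q ^ p) * Z +
          (∑ p ∈ Finset.range (n + 1), q ^ p) * D := by
      rw [← Fin.sum_univ_eq_sum_range (fun p => (p : ℝ) * q ^ p),
        ← Fin.sum_univ_eq_sum_range (fun p => q ^ p), Finset.sum_mul, Finset.sum_mul,
        ← Finset.sum_add_distrib]
      refine Finset.sum_congr rfl fun p _ => ?_
      rw [hZ, hD, Finset.mul_sum, Finset.mul_sum, ← Finset.sum_add_distrib]
      refine Finset.sum_congr rfl fun e _ => ?_
      push_cast
      ring
    have e2 : ∑ p : Fin (n + 1), ∑ e : Equiv.Perm (Fin n), q ^ (p : ℕ) * q ^ mallowsInv e =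
        (∑ p ∈ Finset.range (n + 1), q ^ p) * Z := by
      rw [← Fin.sum_univ_eq_sum_range (fun p => q ^ p), Finset.sum_mul]
      refine Finset.sum_congr rfl fun p _ => ?_
      rw [hZ, Finset.mul_sum]
    rw [e1, e2]
    have h1 := one_sub_mul_sum_mul_pow_le hq0 hq1 (n + 1)
    have hG : 0 ≤ ∑ p ∈ Finset.range (n + 1), q ^ p := Finset.sum_nonneg fun _ _ => by positivity
    have h2 := mul_le_mul_of_nonneg_right h1 hZ0
    have h3 := mul_le_mul_of_nonneg_left ih hG
    push_cast
    linarith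

lemma card_filter_perm_lt {n : ℕ} (π : Equiv.Perm (Fin n)) (a : Fin n) :
    (Finset.univ.filter (fun j => π j < a)).card = a := by
  rw [Finset.card_filter, Equiv.sum_comp π (fun k => if k < a then 1 else 0),
    ← Finset.card_filter, Finset.filter_gt_eq_Iio, Fin.card_Iio]

lemma sum_displacement_le {n : ℕ} (π : Equiv.Perm (Fin n)) :
    ∑ i, ((π i : ℤ) - (i : ℤ)).natAbs ≤ 2 * mallowsInv π := by
  have h : ∀ i, ((π i : ℤ) - (i : ℤ)).natAbs ≤
      (∑ j, if i < j ∧ π j < π i then 1 else 0) + ∑ j, if j < i ∧ π i < π j then 1 else 0 := by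
    intro i
    rw [← Finset.card_filter, ← Finset.card_filter]
    have hi : (Finset.univ.filter (fun j => j < i)).card = i :=
      card_filter_perm_lt (Equiv.refl _) i
    have hπ := card_filter_perm_lt π (π i)
    have h1 : (Finset.univ.filter (fun j => π j < π i)).card ≤
        (Finset.univ.filter (fun j => i < j ∧ π j < π i)).card +
          (Finset.univ.filter (fun j => j < i)).card := by
      refine (Finset.card_le_card fun j hj => ?_).trans (Finset.card_union_le _ _)
      simp only [Finset.mem_filter, Finset.mem_univ, true_and, Finset.mem_union] at hj ⊢
      rcases lt_trichotomy i j with h | h | h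
      · exact Or.inl ⟨h, hj⟩
      · exact absurd hj (by simp [h])
      · exact Or.inr h
    have h2 : (Finset.univ.filter (fun j => j < i)).card ≤
        (Finset.univ.filter (fun j => j < i ∧ π i < π j)).card +
          (Finset.univ.filter (fun j => π j < π i)).card := by
      refine (Finset.card_le_card fun j hj => ?_).trans (Finset.card_union_le _ _)
      simp only [Finset.mem_filter, Finset.mem_univ, true_and, Finset.mem_union] at hj ⊢
      rcases lt_trichotomy (π i) (π j) with h | h | h
      · exact Or.inl ⟨hj, h⟩
      · exact absurd hj (by simp [π.injective h])
      · exact Or.inr h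
    omega
  calc ∑ i, ((π i : ℤ) - (i : ℤ)).natAbs
      ≤ ∑ i, ((∑ j, if i < j ∧ π j < π i then 1 else 0) +
          ∑ j, if j < i ∧ π i < π j then 1 else 0) := Finset.sum_le_sum fun i _ => h i
    _ = mallowsInv π + mallowsInv π := by
        rw [Finset.sum_add_distrib, mallowsInv_eq_sum]
        congr 1
        rw [Finset.sum_comm]
    _ = _ := by ring

/-! ### Shifted blocks -/

lemma card_shift_div_ne_add {m : ℕ} (a d : ℕ) :
    ((Finset.range m).filter (fun s => (a + s) / m ≠ (a + d + s) / m)).card ≤ d := by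
  induction d with
  | zero => simp
  | succ d ih =>
    have h1 : ((Finset.range m).filter (fun s => m ∣ a + d + s + 1)).card ≤ 1 := by
      refine Finset.card_le_one.2 fun s hs t ht => ?_
      simp only [Finset.mem_filter, Finset.mem_range] at hs ht
      obtain ⟨hs, x, hx⟩ := hs
      obtain ⟨ht, y, hy⟩ := ht
      have hxy : x = y := by
        rcases lt_trichotomy x y with h | h | h
        · nlinarith [Nat.mul_le_mul_left m (Nat.succ_le_of_lt h)]
        · exact h
        · nlinarith [Nat.mul_le_mul_left m (Nat.succ_le_of_lt h)]
      subst hxy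
      omega
    refine le_trans (Finset.card_le_card fun s hs => ?_)
      ((Finset.card_union_le _ _).trans (Nat.add_le_add ih h1))
    simp only [Finset.mem_filter, Finset.mem_union] at hs ⊢
    by_contra hc
    push Not at hc
    refine hs.2 ?_
    rw [show a + (d + 1) + s = a + d + s + 1 by ring, Nat.succ_div, if_neg (hc.2 hs.1), add_zero]
    exact hc.1 hs.1

lemma card_shift_div_ne {m : ℕ} (a b : ℕ) :
    ((Finset.range m).filter (fun s => (a + s) / m ≠ (b + s) / m)).card ≤
      ((b : ℤ) - (a : ℤ)).natAbs := by
  rcases le_total a b with h | h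
  · obtain ⟨d, rfl⟩ := Nat.exists_eq_add_of_le h
    refine (card_shift_div_ne_add a d).trans (by omega)
  · obtain ⟨d, rfl⟩ := Nat.exists_eq_add_of_le h
    simp only [ne_comm (a := (b + d + _) / m)]
    refine (card_shift_div_ne_add b d).trans (by omega)

lemma card_shift_div_eq_le {n m : ℕ} (hm : 0 < m) (s k : ℕ) :
    (Finset.univ.filter (fun i : Fin n => (i + s) / m = k)).card ≤ m := by
  have : (Finset.Ico (k * m) (k * m + m)).card = m := by simp
  conv_rhs => rw [← this]
  refine Finset.card_le_card_of_injOn (fun i : Fin n => (i : ℕ) + s) ?_ ?_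
  · intro i hi
    have hi := (Finset.mem_filter.1 (Finset.mem_coe.1 hi)).2
    rw [Nat.div_eq_iff hm] at hi
    simp only [Finset.coe_Ico, Set.mem_Ico]
    omega
  · intro i _ j _ h
    ext
    simpa using h

lemma exists_shift {n m : ℕ} (hm : 0 < m) {q : ℝ} (hq0 : 0 < q) (hq1 : q ≤ 1)
    (hmq : 4 ≤ m * (1 - q)) :
    ∃ s < m, ∑ π : Equiv.Perm (Fin n), q ^ mallowsInv π *
      ((Finset.univ.filter (fun i : Fin n => (i + s) / m ≠ (π i + s) / m)).card : ℝ) ≤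
      n / 2 * ∑ π : Equiv.Perm (Fin n), q ^ mallowsInv π := by
  set Z := ∑ π : Equiv.Perm (Fin n), q ^ mallowsInv π with hZ
  have hZ0 : 0 ≤ Z := Finset.sum_nonneg fun _ _ => by positivity
  have hpt : ∀ π : Equiv.Perm (Fin n), ∑ s ∈ Finset.range m,
      (Finset.univ.filter (fun i : Fin n => (i + s) / m ≠ (π i + s) / m)).card ≤
      2 * mallowsInv π := by
    intro π
    refine le_trans ?_ (sum_displacement_le π)
    simp only [Finset.card_filter]
    rw [Finset.sum_comm]
    simp only [← Finset.card_filter]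
    exact Finset.sum_le_sum fun i _ => card_shift_div_ne i (π i)
  have htot : ∑ s ∈ Finset.range m, ∑ π : Equiv.Perm (Fin n), q ^ mallowsInv π *
      ((Finset.univ.filter (fun i : Fin n => (i + s) / m ≠ (π i + s) / m)).card : ℝ) ≤
      ∑ s ∈ Finset.range m, n / 2 * Z := by
    rw [Finset.sum_comm, Finset.sum_const, Finset.card_range, nsmul_eq_mul]
    have h1 : ∑ π : Equiv.Perm (Fin n), ∑ s ∈ Finset.range m, q ^ mallowsInv π *
        ((Finset.univ.filter (fun i : Fin n => (i + s) / m ≠ (π i + s) / m)).card : ℝ) ≤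
        2 * ∑ π : Equiv.Perm (Fin n), q ^ mallowsInv π * (mallowsInv π : ℝ) := by
      rw [Finset.mul_sum]
      refine Finset.sum_le_sum fun π _ => ?_
      rw [← Finset.mul_sum, mul_left_comm]
      gcongr
      exact_mod_cast hpt π
    refine h1.trans ?_
    set D := ∑ π : Equiv.Perm (Fin n), q ^ mallowsInv π * (mallowsInv π : ℝ) with hD
    have hD0 : 0 ≤ D := Finset.sum_nonneg fun _ _ => by positivity
    have h2 : (1 - q) * D ≤ n * Z := sum_mallowsInv_le hq0 hq1 n
    have h3 := mul_le_mul_of_nonneg_left h2 (Nat.cast_nonneg (α := ℝ) m)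
    have h4 := mul_le_mul_of_nonneg_right hmq hD0
    linarith
  obtain ⟨s, hs, h⟩ := Finset.exists_le_of_sum_le (by simpa using hm.ne') htot
  exact ⟨s, Finset.mem_range.1 hs, h⟩

/-! ### Bounds on the expected longest increasing subsequence -/

lemma sum_LIS_le {n : ℕ} {q : ℝ} (hq0 : 0 < q) (hq1 : q ≤ 1) {blk : Fin n → ℕ}
    (hblk : Monotone blk) {m N : ℕ} (hN : ∀ i, blk i < N)
    (hm : ∀ k, (Finset.univ.filter (fun i => blk i = k)).card ≤ m) :
    ∑ π : Equiv.Perm (Fin n), q ^ mallowsInv π * (LIS π : ℝ) ≤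
      N * (4 * √(m * (q ^ (2 * m))⁻¹)) * ∑ π : Equiv.Perm (Fin n), q ^ mallowsInv π := by
  calc ∑ π : Equiv.Perm (Fin n), q ^ mallowsInv π * (LIS π : ℝ)
      ≤ ∑ π : Equiv.Perm (Fin n), ∑ k ∈ Finset.range N, q ^ mallowsInv π *
          (maxLen (· < ·) π (Finset.univ.filter (fun i => blk i = k)) : ℝ) := by
        refine Finset.sum_le_sum fun π _ => ?_
        rw [← Finset.mul_sum]
        gcongr
        rw [LIS_eq_maxLen]
        exact_mod_cast maxLen_univ_le_sum (· < ·) π hN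
    _ ≤ ∑ _k ∈ Finset.range N, 4 * √(m * (q ^ (2 * m))⁻¹) *
          ∑ π : Equiv.Perm (Fin n), q ^ mallowsInv π := by
        rw [Finset.sum_comm]
        exact Finset.sum_le_sum fun k _ =>
          sum_maxLen_le hq0 hq1 hblk (hm k) fun _ _ h => lt_asymm h
    _ = _ := by rw [Finset.sum_const, Finset.card_range, nsmul_eq_mul]; ring

lemma linear_le_of_le_mul {x l d m S : ℝ} (hl : 0 ≤ l) (hd : 0 ≤ d) (hxm : x ≤ m)
    (hS : 0 < S) (h : x ≤ l * d) (hx : 0 ≤ x) : 2 * x / S - m * d / S ^ 2 ≤ l := by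
  have h1 : 2 * x / S - m * d / S ^ 2 = (2 * x * S - m * d) / S ^ 2 := by field_simp
  rw [h1, div_le_iff₀ (by positivity)]
  have h2 : x * d ≤ m * d := by gcongr
  rcases hd.eq_or_lt with rfl | hd
  · have : x = 0 := by linarith
    subst this
    nlinarith [mul_nonneg hl (sq_nonneg S)]
  · refine le_of_mul_le_mul_right ?_ hd
    nlinarith [mul_le_mul_of_nonneg_right h (sq_nonneg S), mul_nonneg hx (sq_nonneg (S - d))]

lemma linear_le_LIS {n : ℕ} (π : Equiv.Perm (Fin n)) {blk : Fin n → ℕ}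
    (hblk : Monotone blk) {m N : ℕ} (hN : ∀ i, blk i < N)
    (hm : ∀ k, (Finset.univ.filter (fun i => blk i = k)).card ≤ m) {S : ℝ} (hS : 0 < S) :
    2 * ((n : ℝ) - (Finset.univ.filter (fun i => blk i ≠ blk (π i))).card) / S -
      m / S ^ 2 * ∑ k ∈ Finset.range N,
        (maxLen (· > ·) π (Finset.univ.filter (fun i => blk i = k)) : ℝ) ≤ LIS π := by
  classical
  set X : ℕ → Finset (Fin n) := fun k =>
    Finset.univ.filter (fun i => blk i = k ∧ blk (π i) = k) with hX
  have hXB : ∀ k, X k ⊆ Finset.univ.filter (fun i => blk i = k) := fun k i hi => by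
    simp only [hX, Finset.mem_filter, Finset.mem_univ, true_and] at hi ⊢
    exact hi.1
  have hcard : (n : ℝ) - (Finset.univ.filter (fun i => blk i ≠ blk (π i))).card =
      ∑ k ∈ Finset.range N, ((X k).card : ℝ) := by
    have h1 := Finset.card_filter_add_card_filter_not (s := (Finset.univ : Finset (Fin n)))
      (fun i => blk i = blk (π i))
    rw [Finset.card_univ, Fintype.card_fin] at h1
    have h2 := Finset.card_eq_sum_card_fiberwise
      (s := Finset.univ.filter (fun i => blk i = blk (π i))) (f := blk) (t := Finset.range N)
      (fun i _ => by simpa using hN i)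
    have h3 : ∀ k, (Finset.univ.filter (fun i => blk i = blk (π i))).filter (fun i => blk i = k) =
        X k := by
      intro k
      ext i
      simp only [hX, Finset.mem_filter, Finset.mem_univ, true_and]
      omega
    simp only [h3] at h2
    rw [sub_eq_iff_eq_add, ← Nat.cast_sum, ← h2]
    exact_mod_cast h1.symm
  rw [hcard]
  calc _ = ∑ k ∈ Finset.range N, (2 * ((X k).card : ℝ) / S - m *
          (maxLen (· > ·) π (Finset.univ.filter (fun i => blk i = k)) : ℝ) / S ^ 2) := by
        rw [Finset.sum_sub_distrib, Finset.mul_sum, Finset.mul_sum, Finset.sum_div]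
        congr 1
        exact Finset.sum_congr rfl fun k _ => by ring
    _ ≤ ∑ k ∈ Finset.range N, (maxLen (· < ·) π (X k) : ℝ) := by
        refine Finset.sum_le_sum fun k _ => linear_le_of_le_mul (by positivity) (by positivity)
          ?_ hS ?_ (by positivity)
        · exact_mod_cast (Finset.card_le_card (hXB k)).trans (hm k)
        · exact_mod_cast (card_le_maxLen_mul_maxLen π (X k)).trans
            (Nat.mul_le_mul_left _ (maxLen_mono _ _ (hXB k)))
    _ ≤ _ := by exact_mod_cast sum_maxLen_le_LIS π hblk N

lemma le_sum_LIS {n : ℕ} {q : ℝ} (hq0 : 0 < q) (hq1 : q ≤ 1) {blk : Fin n → ℕ}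
    (hblk : Monotone blk) {m N : ℕ} (hN : ∀ i, blk i < N)
    (hm : ∀ k, (Finset.univ.filter (fun i => blk i = k)).card ≤ m)
    (hmis : ∑ π : Equiv.Perm (Fin n), q ^ mallowsInv π *
      ((Finset.univ.filter (fun i => blk i ≠ blk (π i))).card : ℝ) ≤
      n / 2 * ∑ π : Equiv.Perm (Fin n), q ^ mallowsInv π) {S : ℝ} (hS : 0 < S) :
    (n / S - m * N * (4 * √(m * (q ^ (2 * m))⁻¹)) / S ^ 2) *
      ∑ π : Equiv.Perm (Fin n), q ^ mallowsInv π ≤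
    ∑ π : Equiv.Perm (Fin n), q ^ mallowsInv π * (LIS π : ℝ) := by
  set Z := ∑ π : Equiv.Perm (Fin n), q ^ mallowsInv π with hZ
  set M : Equiv.Perm (Fin n) → ℝ := fun π =>
    ((Finset.univ.filter (fun i => blk i ≠ blk (π i))).card : ℝ) with hM
  set d : ℕ → Equiv.Perm (Fin n) → ℝ := fun k π =>
    (maxLen (· > ·) π (Finset.univ.filter (fun i => blk i = k)) : ℝ) with hd
  have hdk : ∑ k ∈ Finset.range N, ∑ π : Equiv.Perm (Fin n), q ^ mallowsInv π * d k π ≤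
      N * (4 * √(m * (q ^ (2 * m))⁻¹) * Z) := by
    rw [← nsmul_eq_mul]
    conv_rhs => rw [← Finset.card_range N, ← Finset.sum_const]
    exact Finset.sum_le_sum fun k _ =>
      sum_maxLen_le hq0 hq1 hblk (hm k) fun _ _ h => lt_asymm h
  have hlow : ∑ π : Equiv.Perm (Fin n), q ^ mallowsInv π *
      (2 * ((n : ℝ) - M π) / S - m / S ^ 2 * ∑ k ∈ Finset.range N, d k π) ≤
      ∑ π : Equiv.Perm (Fin n), q ^ mallowsInv π * (LIS π : ℝ) :=
    Finset.sum_le_sum fun π _ => by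
      gcongr
      exact linear_le_LIS π hblk hN hm hS
  have heq : ∑ π : Equiv.Perm (Fin n), q ^ mallowsInv π *
      (2 * ((n : ℝ) - M π) / S - m / S ^ 2 * ∑ k ∈ Finset.range N, d k π) =
      2 / S * (n * Z - ∑ π : Equiv.Perm (Fin n), q ^ mallowsInv π * M π) -
        m / S ^ 2 *
          ∑ k ∈ Finset.range N, ∑ π : Equiv.Perm (Fin n), q ^ mallowsInv π * d k π := by
    rw [Finset.sum_comm, hZ, Finset.mul_sum, ← Finset.sum_sub_distrib, Finset.mul_sum,
      Finset.mul_sum, ← Finset.sum_sub_distrib]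
    refine Finset.sum_congr rfl fun π _ => ?_
    rw [← Finset.mul_sum]
    ring
  refine le_trans ?_ (heq ▸ hlow)
  have h1 : 2 / S * (n / 2 * Z) ≤
      2 / S * (n * Z - ∑ π : Equiv.Perm (Fin n), q ^ mallowsInv π * M π) := by
    gcongr
    linarith
  have h2 := mul_le_mul_of_nonneg_left hdk (by positivity : 0 ≤ (m : ℝ) / S ^ 2)
  have h3 : (n / S - m * N * (4 * √(m * (q ^ (2 * m))⁻¹)) / S ^ 2) * Z =
      2 / S * (n / 2 * Z) - m / S ^ 2 * (N * (4 * √(m * (q ^ (2 * m))⁻¹) * Z)) := by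
    ring
  linarith

lemma mallowsExp_eq {n : ℕ} (q : ℝ) (f : Equiv.Perm (Fin n) → ℝ) :
    mallowsExp n q f = (∑ π : Equiv.Perm (Fin n), q ^ mallowsInv π * f π) /
      ∑ π : Equiv.Perm (Fin n), q ^ mallowsInv π := by
  unfold mallowsExp mallowsPMF
  rw [Finset.sum_div]
  exact Finset.sum_congr rfl fun π _ => by ring

lemma inv_pow_le_exp {q : ℝ} (hq : 1 / 2 ≤ q) (hq1 : q ≤ 1) {m : ℕ} (hm : m * (1 - q) ≤ 5) :
    (q ^ (2 * m))⁻¹ ≤ Real.exp 20 := by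
  have hq0 : 0 < q := by linarith
  have h1 : q⁻¹ ≤ Real.exp (2 * (1 - q)) := by
    refine le_trans ?_ (Real.add_one_le_exp _)
    rw [inv_le_iff_one_le_mul₀ hq0]
    nlinarith
  calc (q ^ (2 * m))⁻¹ = (q⁻¹) ^ (2 * m) := by rw [inv_pow]
    _ ≤ (Real.exp (2 * (1 - q))) ^ (2 * m) := by gcongr
    _ = Real.exp (4 * (m * (1 - q))) := by rw [← Real.exp_nat_mul]; push_cast; ring_nf
    _ ≤ _ := by
      gcongr
      linarith

/-- There are absolute constants `0 < c ≤ C < ∞` so that for `n≥1`,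
`1/2 ≤ q ≤ 1 − 4/n`, if `π ~ μ_{n,q}` then `c·n·√(1−q) ≤ E(LIS(π)) ≤ C·n·√(1−q)`. -/
theorem mallows_expected_LIS :
    ∃ c C : ℝ, 0 < c ∧ c ≤ C ∧
      ∀ (n : ℕ) (q : ℝ), 1 ≤ n → 1 / 2 ≤ q → q ≤ 1 - 4 / (n : ℝ) →
        c * (n : ℝ) * Real.sqrt (1 - q) ≤ mallowsExp n q (fun π => (LIS π : ℝ)) ∧
        mallowsExp n q (fun π => (LIS π : ℝ)) ≤ C * (n : ℝ) * Real.sqrt (1 - q) := by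
  set R : ℝ := √(5 * Real.exp 20) with hR
  have hR1 : 1 ≤ R := by
    rw [hR, Real.one_le_sqrt]
    linarith [Real.add_one_le_exp (20 : ℝ)]
  refine ⟨1 / (48 * R), 3 * R, by positivity, ?_, ?_⟩
  · rw [div_le_iff₀ (by positivity)]
    nlinarith
  intro n q hn hq hqn
  have hn0 : (0 : ℝ) < n := by exact_mod_cast hn
  have hq0 : 0 < q := by linarith
  have hβn : 4 / (n : ℝ) ≤ 1 - q := by linarith
  have hβ : 0 < 1 - q := lt_of_lt_of_le (by positivity) hβn
  have hq1 : q ≤ 1 := by linarith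
  set m : ℕ := ⌈4 / (1 - q)⌉₊ with hmdef
  have hm4 : 4 / (1 - q) ≤ m := Nat.le_ceil _
  have hm4' : 4 ≤ m * (1 - q) := (div_le_iff₀ hβ).1 hm4
  have hm5 : m * (1 - q) ≤ 5 := by
    have h1 : (m : ℝ) < 4 / (1 - q) + 1 := Nat.ceil_lt_add_one (by positivity)
    have h2 : (m : ℝ) * (1 - q) ≤ (4 / (1 - q) + 1) * (1 - q) := by gcongr
    rw [add_mul, div_mul_cancel₀ _ hβ.ne'] at h2
    linarith
  have hm0 : 0 < m := Nat.ceil_pos.2 (by positivity)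
  have hmn : m ≤ n := by
    rw [hmdef, Nat.ceil_le]
    rw [div_le_iff₀ hn0] at hβn
    rw [div_le_iff₀ hβ]
    linarith
  obtain ⟨s, hs, hmis⟩ := exists_shift (n := n) hm0 hq0 hq1 hm4'
  set blk : Fin n → ℕ := fun i => (i + s) / m with hblk
  have hmono : Monotone blk := fun i j hij =>
    Nat.div_le_div_right (Nat.add_le_add_right hij s)
  have hcard : ∀ k, (Finset.univ.filter (fun i => blk i = k)).card ≤ m :=
    card_shift_div_eq_le hm0 s
  set N := n / m + 2 with hNdef
  have hN : ∀ i, blk i < N := by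
    intro i
    rw [hblk, hNdef]
    have : ((i : ℕ) + s) / m ≤ (n + m) / m := Nat.div_le_div_right (by omega)
    rw [Nat.add_div_right _ hm0] at this
    simp only
    omega
  have hNm : (m : ℝ) * N ≤ 3 * n := by
    have : m * N ≤ 3 * n := by
      rw [hNdef, mul_add]
      have := Nat.mul_div_le n m
      omega
    exact_mod_cast this
  set D := √(m * (q ^ (2 * m))⁻¹) with hD
  have hD0 : 0 < D := by
    rw [hD]
    have : (0 : ℝ) < m := by exact_mod_cast hm0
    positivity
  set b := √(1 - q) with hb
  have hb0 : 0 < b := Real.sqrt_pos.2 hβ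
  have hbb : b * b = 1 - q := Real.mul_self_sqrt hβ.le
  have hDb : D * b ≤ R := by
    rw [hD, hb, hR, ← Real.sqrt_mul (by positivity)]
    refine Real.sqrt_le_sqrt ?_
    calc (m : ℝ) * (q ^ (2 * m))⁻¹ * (1 - q) = (m * (1 - q)) * (q ^ (2 * m))⁻¹ := by ring
      _ ≤ 5 * Real.exp 20 := by
        gcongr
        exact inv_pow_le_exp hq hq1 hm5
  have hZ : 0 < ∑ π : Equiv.Perm (Fin n), q ^ mallowsInv π :=
    Finset.sum_pos (fun _ _ => by positivity) Finset.univ_nonempty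
  rw [mallowsExp_eq]
  constructor
  · rw [le_div_iff₀ hZ]
    refine le_trans ?_ (le_sum_LIS hq0 hq1 hmono hN hcard hmis (S := 24 * D) (by positivity))
    gcongr
    rw [← hD]
    calc 1 / (48 * R) * n * b ≤ n / (48 * D) := by
          rw [le_div_iff₀ (by positivity)]
          calc 1 / (48 * R) * n * b * (48 * D) = n * (D * b) / R := by field_simp
            _ ≤ n * R / R := by gcongr
            _ = n := by field_simp
      _ = n / (24 * D) - 3 * n * (4 * D) / (24 * D) ^ 2 := by field_simp; norm_num
      _ ≤ _ := by gcongr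
  · rw [div_le_iff₀ hZ]
    refine (sum_LIS_le hq0 hq1 hmono hN hcard).trans ?_
    refine mul_le_mul_of_nonneg_right ?_ hZ.le
    rw [← hD]
    have h1 : (4 : ℝ) * (N * D) ≤ (m * (1 - q)) * (N * D) := by gcongr
    calc N * (4 * D) = 4 * (N * D) := by ring
      _ ≤ (m * (1 - q)) * (N * D) := h1
      _ = (m * N) * (D * b) * b := by rw [← hbb]; ring
      _ ≤ (3 * n) * R * b := by gcongr
      _ = _ := by ring
end

section
/- Let n≥1 be an integer and 0 < q ≤ 1. If π is distributed according to the (n,q)-Mallows measure, then n(1−q) ≤ E(LIS(π)) ≤ n − (q/(1+q))·(n−1). -/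
open Finset

/-- Undoing an inversion by a transposition of positions lowers the number of inversions. -/
lemma mallowsInv_mul_swap_lt {n : ℕ} (π : Equiv.Perm (Fin n)) {i j : Fin n} (hij : i < j)
    (h : π j < π i) : mallowsInv (π * Equiv.swap i j) < mallowsInv π := by
  have hmem : (i, j) ∈ univ.filter (fun p : Fin n × Fin n => p.1 < p.2 ∧ π p.2 < π p.1) := by
    simp [hij, h]
  unfold mallowsInv
  rw [← card_erase_add_one hmem, Nat.lt_succ_iff]
  set s := Equiv.swap i j
  have hss : ∀ x, s (s x) = x := fun x => Equiv.swap_apply_self i j x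
  have hsi : s i = j := Equiv.swap_apply_left i j
  have hsj : s j = i := Equiv.swap_apply_right i j
  have hso : ∀ x, x ≠ i → x ≠ j → s x = x := fun x => Equiv.swap_apply_of_ne_of_ne
  apply card_le_card_of_injOn (fun p => if s p.1 < s p.2 then (s p.1, s p.2) else p)
  · rintro ⟨a, b⟩ hab
    simp only [coe_filter, mem_univ, true_and, Set.mem_ofPred_eq] at hab
    simp only [Equiv.Perm.mul_apply] at hab
    obtain ⟨hab, hinv⟩ := hab
    simp only [coe_erase, coe_filter, mem_univ, true_and, Set.mem_sdiff, Set.mem_ofPred_eq,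
      Set.mem_singleton_iff]
    split_ifs with hlt
    · refine ⟨⟨hlt, hinv⟩, fun he => ?_⟩
      simp only [Prod.mk.injEq] at he
      have ha := hss a
      have hb := hss b
      rw [he.1, hsi] at ha
      rw [he.2, hsj] at hb
      rw [← ha, ← hb] at hab
      exact lt_asymm hij hab
    · by_cases hai : a = i
      · subst hai
        by_cases hbj : b = j
        · subst hbj
          rw [hsi, hsj] at hinv
          exact absurd hinv (lt_asymm h)
        · rw [hso b hab.ne' hbj, hsi] at hinv
          exact ⟨⟨hab, hinv.trans h⟩, fun he => hbj (Prod.mk.inj he).2⟩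
      · by_cases hbj : b = j
        · subst hbj
          rw [hso a hai hab.ne, hsj] at hinv
          exact ⟨⟨hab, h.trans hinv⟩, fun he => hai (Prod.mk.inj he).1⟩
        · exfalso
          apply hlt
          by_cases haj : a = j
          · subst haj
            rw [hsj, hso b (hij.trans hab).ne' hbj]
            exact hij.trans hab
          · rw [hso a hai haj]
            by_cases hbi : b = i
            · subst hbi
              rw [hsi]
              exact hab.trans hij
            · rwa [hso b hbi hbj]
  · rintro ⟨a, b⟩ hab ⟨c, d⟩ hcd he
    simp only [coe_filter, mem_univ, true_and, Set.mem_ofPred_eq] at hab hcd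
    dsimp only at he
    split_ifs at he with h1 h2 h2
    · simp only [Prod.mk.injEq, EmbeddingLike.apply_eq_iff_eq] at he
      rw [he.1, he.2]
    · simp only [Prod.mk.injEq] at he
      rw [← he.1, ← he.2, hss, hss] at h2
      exact absurd hab.1 h2
    · simp only [Prod.mk.injEq] at he
      rw [he.1, he.2, hss, hss] at h1
      exact absurd hcd.1 h1
    · exact he

/-- An adjacent transposition of positions raises the number of inversions by at most one. -/
lemma mallowsInv_mul_swap_le {m : ℕ} (π : Equiv.Perm (Fin (m + 1))) (i : Fin m) :
    mallowsInv (π * Equiv.swap i.castSucc i.succ) ≤ mallowsInv π + 1 := by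
  unfold mallowsInv
  refine le_trans (Nat.le_succ_of_pred_le (pred_card_le_card_erase (a := (i.castSucc, i.succ)))) ?_
  apply Nat.succ_le_succ
  set s := Equiv.swap i.castSucc i.succ
  have hsi : s i.castSucc = i.succ := Equiv.swap_apply_left _ _
  have hsj : s i.succ = i.castSucc := Equiv.swap_apply_right _ _
  have hso : ∀ x, x ≠ i.castSucc → x ≠ i.succ → s x = x :=
    fun x => Equiv.swap_apply_of_ne_of_ne
  apply card_le_card_of_injOn (fun p => (s p.1, s p.2))
  · rintro ⟨a, b⟩ hab
    simp only [coe_erase, coe_filter, mem_univ, true_and, Set.mem_sdiff, Set.mem_ofPred_eq,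
      Set.mem_singleton_iff, Prod.mk.injEq] at hab
    simp only [Equiv.Perm.mul_apply] at hab
    obtain ⟨⟨hab, hinv⟩, hne⟩ := hab
    simp only [coe_filter, mem_univ, true_and, Set.mem_ofPred_eq]
    refine ⟨?_, hinv⟩
    by_cases hai : a = i.castSucc
    · have hb : b ≠ i.succ := fun hb => hne ⟨hai, hb⟩
      rw [hai, hsi, hso b (hai ▸ hab.ne') hb]
      rw [hai] at hab
      simp only [Fin.lt_def, ne_eq, Fin.ext_iff, Fin.val_castSucc, Fin.val_succ] at *
      omega
    · by_cases haj : a = i.succ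
      · rw [haj] at hab ⊢
        rw [hsj, hso b (by rintro rfl; simp [Fin.lt_def] at hab) hab.ne']
        simp only [Fin.lt_def, Fin.val_castSucc, Fin.val_succ] at *
        omega
      · rw [hso a hai haj]
        by_cases hbi : b = i.castSucc
        · rw [hbi] at hab ⊢
          rw [hsi]
          simp only [Fin.lt_def, Fin.val_castSucc, Fin.val_succ] at *
          omega
        · by_cases hbj : b = i.succ
          · rw [hbj] at hab ⊢
            rw [hsj]
            simp only [Fin.lt_def, Fin.ext_iff, Fin.val_castSucc, Fin.val_succ] at *
            omega
          · rwa [hso b hbi hbj]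
  · rintro ⟨a, b⟩ - ⟨c, d⟩ - he
    simpa using he

lemma exists_ascent_between {m : ℕ} {α : Type*} [LinearOrder α] (π : Fin (m + 1) → α)
    {a b : Fin (m + 1)} (hab : a < b) (h : π a < π b) :
    ∃ i : Fin m, a ≤ i.castSucc ∧ i.succ ≤ b ∧ π i.castSucc < π i.succ := by
  by_contra! hcon
  have key : ∀ c : Fin (m + 1), a ≤ c → c ≤ b → π c ≤ π a := by
    intro c
    induction c using Fin.induction with
    | zero =>
      intro hac _
      rw [le_antisymm hac (Fin.zero_le a)]
    | succ i ih =>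
      intro hac hcb
      rcases hac.eq_or_lt with he | hlt
      · rw [he]
      · have hai : a ≤ i.castSucc := Fin.le_castSucc_iff.mpr hlt
        exact (hcon i hai hcb).trans (ih hai ((Fin.castSucc_lt_succ).le.trans hcb))
  exact absurd h (key b hab.le le_rfl).not_gt

lemma LIS_le_one_add_card_ascents {m : ℕ} (π : Equiv.Perm (Fin (m + 1))) :
    LIS π ≤ 1 + (univ.filter (fun i : Fin m => π i.castSucc < π i.succ)).card := by
  unfold LIS
  refine csSup_le ⟨0, Fin.elim0, fun i => i.elim0, fun i => i.elim0⟩ ?_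
  rintro (_ | k) ⟨f, hf, hπ⟩
  · omega
  have hex : ∀ j : Fin k, _ := fun j =>
    exists_ascent_between π (hf (Fin.castSucc_lt_succ (i := j)))
      (hπ (Fin.castSucc_lt_succ (i := j)))
  choose g hg1 hg2 hg3 using hex
  have hmono : StrictMono g := by
    intro j j' hjj
    have h1 : (g j).succ ≤ (g j').castSucc :=
      ((hg2 j).trans (hf.monotone (Fin.succ_le_castSucc_iff.mpr hjj))).trans (hg1 j')
    exact Fin.succ_le_castSucc_iff.mp h1
  have := card_le_card_of_injOn (s := (univ : Finset (Fin k)))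
    (t := univ.filter (fun i : Fin m => π i.castSucc < π i.succ)) g
    (fun j _ => by simpa using hg3 j) hmono.injective.injOn
  rw [card_univ, Fintype.card_fin] at this
  omega

lemma card_le_LIS_of_strictMonoOn {n : ℕ} (π : Equiv.Perm (Fin n)) (R : Finset (Fin n))
    (hR : StrictMonoOn π R) : R.card ≤ LIS π := by
  apply le_csSup
  · refine ⟨n, ?_⟩
    rintro m ⟨f, hf, -⟩
    simpa using Fintype.card_le_of_injective f hf.injective
  · exact ⟨R.orderEmbOfFin rfl, (R.orderEmbOfFin rfl).strictMono, fun a b hab =>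
      hR (R.orderEmbOfFin_mem rfl a) (R.orderEmbOfFin_mem rfl b)
        ((R.orderEmbOfFin rfl).strictMono hab)⟩

lemma exists_max_smaller_right {n : ℕ} (π : Equiv.Perm (Fin n)) (i : Fin n)
    (h : ∃ j, i < j ∧ π j < π i) :
    ∃ j, i < j ∧ π j < π i ∧ ∀ k, i < k → π k < π i → π k ≤ π j := by
  obtain ⟨j, hj, hmax⟩ := exists_max_image (univ.filter (fun j => i < j ∧ π j < π i)) π
    (by obtain ⟨j, hj⟩ := h; exact ⟨j, by simpa using hj⟩)
  simp only [mem_filter, mem_univ, true_and, and_imp] at hj hmax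
  exact ⟨j, hj.1, hj.2, hmax⟩

/-- The weight of the permutations having a smaller value to the right of position `i`
is at most `q` times the total weight. -/
lemma sum_weight_smaller_right_le {n : ℕ} {q : ℝ} (hq0 : 0 < q) (hq1 : q ≤ 1) (i : Fin n) :
    ∑ π : Equiv.Perm (Fin n) with ∃ j, i < j ∧ π j < π i, q ^ mallowsInv π ≤
      q * ∑ π : Equiv.Perm (Fin n), q ^ mallowsInv π := by
  have : Nonempty (Fin n) := ⟨i⟩
  have hex := fun π : Equiv.Perm (Fin n) => exists_max_smaller_right π i
  choose! g hg1 hg2 hg3 using hex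
  set B := univ.filter (fun π : Equiv.Perm (Fin n) => ∃ j, i < j ∧ π j < π i) with hB
  have hmB : ∀ π, π ∈ B ↔ ∃ j, i < j ∧ π j < π i := by simp [hB]
  have aux : ∀ π ∈ B, ∀ τ ∈ B, π * Equiv.swap i (g π) = τ * Equiv.swap i (g τ) →
      ¬ τ (g π) < π (g τ) := by
    intro π hπ τ hτ he hlt
    rw [hmB] at hπ hτ
    have hv : ∀ x, π (Equiv.swap i (g π) x) = τ (Equiv.swap i (g τ) x) := fun x => by
      simpa using congrArg (fun σ : Equiv.Perm (Fin n) => σ x) he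
    have hne : g π ≠ g τ := by
      intro h
      have := hv i
      simp only [Equiv.swap_apply_left] at this
      have h2 := hv (g π)
      rw [Equiv.swap_apply_right, h, Equiv.swap_apply_right] at h2
      rw [h] at hlt this
      exact absurd this hlt.ne'
    have h0 := hv i
    have h1 := hv (g π)
    have h2 := hv (g τ)
    rw [Equiv.swap_apply_left, Equiv.swap_apply_left] at h0
    rw [Equiv.swap_apply_right, Equiv.swap_apply_of_ne_of_ne (hg1 π hπ).ne' hne] at h1
    rw [Equiv.swap_apply_right, Equiv.swap_apply_of_ne_of_ne (hg1 τ hτ).ne' hne.symm] at h2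
    have h3 := hg3 τ hτ (g π) (hg1 π hπ) (h2 ▸ hlt)
    rw [← h0, ← h1] at h3
    exact absurd (hg2 π hπ) h3.not_gt
  have hinj : Set.InjOn (fun π : Equiv.Perm (Fin n) => π * Equiv.swap i (g π)) B := by
    intro π hπ τ hτ he
    have hv : ∀ x, π (Equiv.swap i (g π) x) = τ (Equiv.swap i (g τ) x) := fun x => by
      simpa using congrArg (fun σ : Equiv.Perm (Fin n) => σ x) he
    have hπ' := (hmB π).1 hπ
    have hτ' := (hmB τ).1 hτ
    have hgg : g π = g τ := by
      by_contra hne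
      rcases lt_trichotomy (τ (g π)) (π (g τ)) with h | h | h
      · exact aux π hπ τ hτ he h
      · have h1 := hv (g π)
        rw [Equiv.swap_apply_right, Equiv.swap_apply_of_ne_of_ne (hg1 π hπ').ne' hne] at h1
        exact absurd (π.injective (h1.trans h)) (hg1 τ hτ').ne
      · exact aux τ hτ π hπ he.symm h
    simp only [hgg] at he
    exact mul_right_cancel he
  calc ∑ π ∈ B, q ^ mallowsInv π
      ≤ ∑ π ∈ B, q * q ^ mallowsInv (π * Equiv.swap i (g π)) := by
        apply sum_le_sum
        intro π hπ
        have h := (hmB π).1 hπ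
        rw [← pow_succ']
        exact pow_le_pow_of_le_one hq0.le hq1 (mallowsInv_mul_swap_lt π (hg1 π h) (hg2 π h))
    _ = q * ∑ σ ∈ B.image (fun π => π * Equiv.swap i (g π)), q ^ mallowsInv σ := by
        rw [sum_image hinj, mul_sum]
    _ ≤ q * ∑ π : Equiv.Perm (Fin n), q ^ mallowsInv π := by
        gcongr
        exact subset_univ _

/-- The weight of the permutations ascending at `i` is at most a `1 / (1 + q)` fraction
of the total weight. -/
lemma sum_weight_ascent_le {m : ℕ} {q : ℝ} (hq0 : 0 < q) (hq1 : q ≤ 1) (i : Fin m) :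
    (1 + q) * ∑ π : Equiv.Perm (Fin (m + 1)) with π i.castSucc < π i.succ, q ^ mallowsInv π ≤
      ∑ π : Equiv.Perm (Fin (m + 1)), q ^ mallowsInv π := by
  rw [← sum_filter_add_sum_filter_not univ
    (fun π : Equiv.Perm (Fin (m + 1)) => π i.castSucc < π i.succ) (fun π => q ^ mallowsInv π),
    add_mul, one_mul, mul_sum]
  apply add_le_add le_rfl
  have hsw : ∀ π ∈ univ.filter (fun π : Equiv.Perm (Fin (m + 1)) => π i.castSucc < π i.succ),
      π * Equiv.swap i.castSucc i.succ ∈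
        univ.filter (fun π : Equiv.Perm (Fin (m + 1)) => ¬ π i.castSucc < π i.succ) := by
    intro π hπ
    simp only [mem_filter, mem_univ, true_and, Equiv.Perm.mul_apply, Equiv.swap_apply_left,
      Equiv.swap_apply_right, not_lt] at hπ ⊢
    exact hπ.le
  calc _ ≤ ∑ π : Equiv.Perm (Fin (m + 1)) with π i.castSucc < π i.succ,
        q ^ mallowsInv (π * Equiv.swap i.castSucc i.succ) := by
        apply sum_le_sum
        intro π _
        rw [← pow_succ']
        exact pow_le_pow_of_le_one hq0.le hq1 (mallowsInv_mul_swap_le π i)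
    _ = ∑ σ ∈ (univ.filter (fun π : Equiv.Perm (Fin (m + 1)) => π i.castSucc < π i.succ)).image
          (fun π => π * Equiv.swap i.castSucc i.succ), q ^ mallowsInv σ := by
        rw [sum_image (fun _ _ _ _ h => mul_right_cancel h)]
    _ ≤ _ := by
        apply sum_le_sum_of_subset_of_nonneg (image_subset_iff.mpr hsw)
        intros
        positivity

lemma sum_weight_mul_card_filter {α ι : Type*} [Fintype α] [Fintype ι] (w : α → ℝ)
    (P : ι → α → Prop) [∀ i, DecidablePred (P i)] [∀ a, DecidablePred (P · a)] :
    ∑ a, w a * ((univ.filter (P · a)).card : ℝ) = ∑ i, ∑ a with P i a, w a := by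
  simp_rw [sum_filter, card_filter]
  push_cast
  simp_rw [mul_sum]
  rw [sum_comm]
  refine sum_congr rfl fun i _ => sum_congr rfl fun a _ => ?_
  split_ifs <;> simp

lemma sum_weight_pos (n : ℕ) {q : ℝ} (hq0 : 0 < q) :
    0 < ∑ π : Equiv.Perm (Fin n), q ^ mallowsInv π :=
  sum_pos (fun _ _ => by positivity) univ_nonempty

lemma mallowsExp_eq_div (n : ℕ) (q : ℝ) (f : Equiv.Perm (Fin n) → ℝ) :
    mallowsExp n q f =
      (∑ π, q ^ mallowsInv π * f π) / ∑ π : Equiv.Perm (Fin n), q ^ mallowsInv π := by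
  simp only [mallowsExp, mallowsPMF, sum_div, div_mul_eq_mul_div]

lemma mul_one_sub_le_mallowsExp_LIS (n : ℕ) {q : ℝ} (hq0 : 0 < q) (hq1 : q ≤ 1) :
    (n : ℝ) * (1 - q) ≤ mallowsExp n q (fun π => (LIS π : ℝ)) := by
  rw [mallowsExp_eq_div, le_div_iff₀ (sum_weight_pos n hq0)]
  have hcard : ∀ π : Equiv.Perm (Fin n),
      (univ.filter (fun i => ¬ ∃ j, i < j ∧ π j < π i)).card ≤ LIS π := by
    intro π
    apply card_le_LIS_of_strictMonoOn
    intro a ha b hb hab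
    simp only [coe_filter, mem_univ, true_and, Set.mem_ofPred_eq, not_exists, not_and,
      not_lt] at ha
    exact (ha b hab).lt_of_ne (fun h => hab.ne (π.injective h))
  calc (n : ℝ) * (1 - q) * ∑ π : Equiv.Perm (Fin n), q ^ mallowsInv π
      = ∑ i : Fin n, (1 - q) * ∑ π : Equiv.Perm (Fin n), q ^ mallowsInv π := by
        simp [mul_assoc]
    _ ≤ ∑ i : Fin n, ∑ π : Equiv.Perm (Fin n) with ¬ ∃ j, i < j ∧ π j < π i,
          q ^ mallowsInv π := by
        apply sum_le_sum
        intro i _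
        have h1 := sum_weight_smaller_right_le hq0 hq1 i
        have h2 := sum_filter_add_sum_filter_not univ
          (fun π : Equiv.Perm (Fin n) => ∃ j, i < j ∧ π j < π i) (fun π => q ^ mallowsInv π)
        linarith
    _ = ∑ π : Equiv.Perm (Fin n), q ^ mallowsInv π *
          ((univ.filter (fun i => ¬ ∃ j, i < j ∧ π j < π i)).card : ℝ) :=
        (sum_weight_mul_card_filter (fun π : Equiv.Perm (Fin n) => q ^ mallowsInv π)
          (fun i π => ¬ ∃ j, i < j ∧ π j < π i)).symm
    _ ≤ _ := by
        gcongr with π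
        exact hcard π

lemma mallowsExp_LIS_le (m : ℕ) {q : ℝ} (hq0 : 0 < q) (hq1 : q ≤ 1) :
    mallowsExp (m + 1) q (fun π => (LIS π : ℝ)) ≤ 1 + m / (1 + q) := by
  rw [mallowsExp_eq_div, div_le_iff₀ (sum_weight_pos (m + 1) hq0)]
  calc ∑ π : Equiv.Perm (Fin (m + 1)), q ^ mallowsInv π * (LIS π : ℝ)
      ≤ ∑ π : Equiv.Perm (Fin (m + 1)), (q ^ mallowsInv π + q ^ mallowsInv π *
          ((univ.filter (fun i : Fin m => π i.castSucc < π i.succ)).card : ℝ)) := by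
        apply sum_le_sum
        intro π _
        rw [← mul_one_add]
        gcongr
        exact_mod_cast LIS_le_one_add_card_ascents π
    _ = ∑ π : Equiv.Perm (Fin (m + 1)), q ^ mallowsInv π +
          ∑ i : Fin m, ∑ π : Equiv.Perm (Fin (m + 1)) with π i.castSucc < π i.succ,
            q ^ mallowsInv π := by
        rw [sum_add_distrib, sum_weight_mul_card_filter
          (fun π : Equiv.Perm (Fin (m + 1)) => q ^ mallowsInv π)
          (fun (i : Fin m) π => π i.castSucc < π i.succ)]
    _ ≤ ∑ π : Equiv.Perm (Fin (m + 1)), q ^ mallowsInv π +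
          ∑ _i : Fin m, (∑ π : Equiv.Perm (Fin (m + 1)), q ^ mallowsInv π) / (1 + q) := by
        gcongr with i
        rw [le_div_iff₀' (by positivity)]
        exact sum_weight_ascent_le hq0 hq1 i
    _ = _ := by
        rw [sum_const, card_univ, Fintype.card_fin, nsmul_eq_mul]
        ring

/-- For `n≥1` and `0 < q ≤ 1`, if `π ~ μ_{n,q}` then
`n(1−q) ≤ E(LIS(π)) ≤ n − (q/(1+q))·(n−1)`. -/
theorem mallows_expected_LIS_small_q (n : ℕ) (hn : 1 ≤ n) (q : ℝ)
    (hq0 : 0 < q) (hq1 : q ≤ 1) :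
    (n : ℝ) * (1 - q) ≤ mallowsExp n q (fun π => (LIS π : ℝ)) ∧
    mallowsExp n q (fun π => (LIS π : ℝ)) ≤ (n : ℝ) - q / (1 + q) * ((n : ℝ) - 1) := by
  refine ⟨mul_one_sub_le_mallowsExp_LIS n hq0 hq1, ?_⟩
  obtain ⟨m, rfl⟩ := Nat.exists_eq_add_of_le' hn
  refine (mallowsExp_LIS_le m hq0 hq1).trans_eq ?_
  push_cast
  field_simp
  ring
end
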